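/- Let n ≥ 2 be a natural number. Then the strong n-th James constant of Λ_∞ equals n; that is, sup{ min over all sign choices ε_j ∈ {−1, +1} of ‖∑_{j=0}^{n−1} ε_j x_j‖_∞ : x_0, …, x_{n−1} real sequences with ‖x_j‖_∞ = 1 for each j } = n. -/

import Mathlib

open Filter Topology

/-- Weight `λ_k − λ_{k−1}` with the convention `λ_{−1} = 0`. -/
noncomputable def dLam (l : ℕ → ℝ) (k : ℕ) : ℝ :=
  l k - (if k = 0 then 0 else l (k - 1))

/-- `Λx(n) = (1/λ_n) ∑_{k=0}^n (λ_k − λ_{k−1})|x_k|`. -/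
noncomputable def LamAvg (l : ℕ → ℝ) (x : ℕ → ℝ) (n : ℕ) : ℝ :=
  (1 / l n) * ∑ k ∈ Finset.range (n + 1), dLam l k * |x k|

/-- The norm of the space `Λ_∞`, `‖x‖_∞ = sup_n Λx(n)`. -/
noncomputable def LamNormInf (l : ℕ → ℝ) (x : ℕ → ℝ) : ℝ :=
  ⨆ n : ℕ, LamAvg l x n

theorem sum_range_dLam (l : ℕ → ℝ) (N : ℕ) :
    ∑ k ∈ Finset.range (N + 1), dLam l k = l N := by
  induction N with
  | zero => simp [dLam]
  | succ N ih => rw [Finset.sum_range_succ, ih]; simp [dLam]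

theorem dLam_nonneg {l : ℕ → ℝ} (hpos : ∀ k, 0 < l k) (hmono : Monotone l) (k : ℕ) :
    0 ≤ dLam l k := by
  rcases k with _ | k
  · simpa [dLam] using (hpos 0).le
  · simpa [dLam] using hmono k.le_succ

theorem LamAvg_nonneg {l : ℕ → ℝ} (hpos : ∀ k, 0 < l k) (hmono : Monotone l)
    (x : ℕ → ℝ) (N : ℕ) : 0 ≤ LamAvg l x N :=
  mul_nonneg (one_div_nonneg.2 (hpos N).le)
    (Finset.sum_nonneg fun k _ => mul_nonneg (dLam_nonneg hpos hmono k) (abs_nonneg _))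

theorem LamNormInf_nonneg {l : ℕ → ℝ} (hpos : ∀ k, 0 < l k) (hmono : Monotone l)
    (x : ℕ → ℝ) : 0 ≤ LamNormInf l x :=
  Real.iSup_nonneg fun N => LamAvg_nonneg hpos hmono x N

theorem LamAvg_le_one_of_LamNormInf_eq_one {l x : ℕ → ℝ} (h : LamNormInf l x = 1) (N : ℕ) :
    LamAvg l x N ≤ 1 := by
  have hb : BddAbove (Set.range (LamAvg l x)) := by
    by_contra hb
    have h0 : LamNormInf l x = 0 := Real.iSup_of_not_bddAbove hb
    linarith
  exact (le_ciSup hb N).trans_eq h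

theorem LamAvg_mono {l : ℕ → ℝ} (hpos : ∀ k, 0 < l k) (hmono : Monotone l)
    {x y : ℕ → ℝ} (h : ∀ k, |x k| ≤ |y k|) (N : ℕ) : LamAvg l x N ≤ LamAvg l y N :=
  mul_le_mul_of_nonneg_left
    (Finset.sum_le_sum fun k _ => mul_le_mul_of_nonneg_left (h k) (dLam_nonneg hpos hmono k))
    (one_div_nonneg.2 (hpos N).le)

theorem LamAvg_signed_sum_le {l : ℕ → ℝ} (hpos : ∀ k, 0 < l k) (hmono : Monotone l)
    {ι : Type*} [Fintype ι] {x : ι → ℕ → ℝ} (hx : ∀ j, LamNormInf l (x j) = 1)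
    {ε : ι → ℝ} (hε : ∀ j, ε j = 1 ∨ ε j = -1) (N : ℕ) :
    LamAvg l (fun k => ∑ j, ε j * x j k) N ≤ Fintype.card ι := by
  have habs : ∀ j, |ε j| = 1 := fun j => by rcases hε j with h | h <;> simp [h]
  calc LamAvg l (fun k => ∑ j, ε j * x j k) N
      ≤ LamAvg l (fun k => ∑ j, |x j k|) N := by
        refine LamAvg_mono hpos hmono (fun k => ?_) N
        rw [abs_of_nonneg (Finset.sum_nonneg fun j _ => abs_nonneg (x j k))]
        refine (Finset.abs_sum_le_sum_abs _ _).trans_eq ?_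
        simp [abs_mul, habs]
    _ = ∑ j, LamAvg l (x j) N := by
        simp only [LamAvg]
        rw [← Finset.mul_sum, Finset.sum_comm]
        congr 1
        refine Finset.sum_congr rfl fun k _ => ?_
        rw [abs_of_nonneg (Finset.sum_nonneg fun j _ => abs_nonneg (x j k)), Finset.mul_sum]
    _ ≤ ∑ _j : ι, (1 : ℝ) :=
        Finset.sum_le_sum fun j _ => LamAvg_le_one_of_LamNormInf_eq_one (hx j) N
    _ = Fintype.card ι := by simp

theorem LamNormInf_eq_one_of_abs_eq_one {l x : ℕ → ℝ} (hpos : ∀ k, 0 < l k)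
    (hx : ∀ k, |x k| = 1) : LamNormInf l x = 1 := by
  have h : ∀ N, LamAvg l x N = 1 := fun N => by
    simp [LamAvg, hx, sum_range_dLam, (hpos N).ne']
  simp [LamNormInf, h]

/-- The indices can be coloured so that each colour of a finite set carries, along some initial
segment, all but a fraction `δ` of the total weight. -/
theorem exists_coloring_LamAvg_indicator {P : Type*} [DecidableEq P] [Nonempty P] {l : ℕ → ℝ}
    (hpos : ∀ k, 0 < l k) (hmono : Monotone l) (htop : Tendsto l atTop atTop)
    {δ : ℝ} (hδ : 0 < δ) (S : Finset P) :
    ∃ (f : ℕ → P) (M : ℕ), ∀ p ∈ S, ∃ N ≤ M,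
      1 - δ ≤ LamAvg l (fun k => if f k = p then 1 else 0) N := by
  induction S using Finset.induction_on with
  | empty => exact ⟨fun _ => Classical.arbitrary P, 0, by simp⟩
  | insert p S _ ih =>
    obtain ⟨f, M, hf⟩ := ih
    obtain ⟨N, hN, hMN⟩ := ((htop.eventually_ge_atTop (l M / δ)).and
      (eventually_ge_atTop M)).exists
    refine ⟨fun k => if k ≤ M then f k else p, N, fun q hq => ?_⟩
    rcases Finset.mem_insert.1 hq with rfl | hq
    · refine ⟨N, le_rfl, ?_⟩
      have hsplit : l N - l M ≤ ∑ k ∈ Finset.range (N + 1),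
          dLam l k * |if (if k ≤ M then f k else q) = q then (1 : ℝ) else 0| := by
        rw [← sum_range_dLam l N, ← sum_range_dLam l M,
          ← Finset.sum_range_add_sum_Ico _ (Nat.succ_le_succ hMN), add_sub_cancel_left,
          ← Finset.sum_range_add_sum_Ico _ (Nat.succ_le_succ hMN)]
        refine le_add_of_nonneg_of_le (Finset.sum_nonneg fun k _ =>
          mul_nonneg (dLam_nonneg hpos hmono k) (abs_nonneg _)) (Finset.sum_le_sum fun k hk => ?_)
        have : ¬ k ≤ M := by have := (Finset.mem_Ico.1 hk).1; omega
        simp [this]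
      rw [div_le_iff₀ hδ] at hN
      rw [LamAvg, one_div, ← div_eq_inv_mul, le_div_iff₀ (hpos N)]
      linarith
    · obtain ⟨K, hK, hKf⟩ := hf q hq
      refine ⟨K, hK.trans hMN, hKf.trans_eq ?_⟩
      simp only [LamAvg]
      congr 1
      refine Finset.sum_congr rfl fun k hk => ?_
      have : k ≤ M := by have := Finset.mem_range.1 hk; omega
      simp [this]

theorem LamAvg_const_mul (l x : ℕ → ℝ) (c : ℝ) (N : ℕ) :
    LamAvg l (fun k => c * x k) N = |c| * LamAvg l x N := by
  simp only [LamAvg, abs_mul, Finset.mul_sum]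
  exact Finset.sum_congr rfl fun k _ => by ring

theorem exists_forall_signed_sum_LamNormInf_ge {l : ℕ → ℝ} (hpos : ∀ k, 0 < l k)
    (hmono : Monotone l) (htop : Tendsto l atTop atTop) {δ : ℝ} (hδ : 0 < δ)
    (ι : Type*) [Fintype ι] :
    ∃ x : ι → ℕ → ℝ, (∀ j, LamNormInf l (x j) = 1) ∧
      ∀ ε : ι → ℝ, (∀ j, ε j = 1 ∨ ε j = -1) →
        Fintype.card ι * (1 - δ) ≤ LamNormInf l (fun k => ∑ j, ε j * x j k) := by
  classical
  obtain ⟨f, M, hf⟩ := exists_coloring_LamAvg_indicator (P := ι → Bool) hpos hmono htop hδ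
    Finset.univ
  have hx : ∀ j, LamNormInf l (fun k => if f k j then (1 : ℝ) else -1) = 1 := fun j =>
    LamNormInf_eq_one_of_abs_eq_one hpos fun k => by split_ifs <;> simp
  refine ⟨fun j k => if f k j then 1 else -1, hx, fun ε hε => ?_⟩
  obtain ⟨N, _, hN⟩ := hf (fun j => decide (ε j = 1)) (Finset.mem_univ _)
  have hbdd : BddAbove (Set.range
      (LamAvg l (fun k => ∑ j, ε j * (if f k j then (1 : ℝ) else -1)))) :=
    ⟨Fintype.card ι, by rintro _ ⟨K, rfl⟩; exact LamAvg_signed_sum_le hpos hmono hx hε K⟩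
  refine le_trans ?_ (le_ciSup hbdd N)
  refine (mul_le_mul_of_nonneg_left hN (Nat.cast_nonneg _)).trans ?_
  rw [← abs_of_nonneg (Nat.cast_nonneg (α := ℝ) (Fintype.card ι)), ← LamAvg_const_mul]
  refine LamAvg_mono hpos hmono (fun k => ?_) N
  split_ifs with hk
  · have : ∀ j, ε j * (if f k j then (1 : ℝ) else -1) = 1 := fun j => by
      rw [hk]
      rcases hε j with h | h <;> norm_num [h]
    simp [this]
  · simp

/-- The strong `n`-th James constant of `Λ_∞` equals `n`. -/
theorem strong_nth_james_constant_LamInf (l : ℕ → ℝ) (n : ℕ)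
    (hpos : ∀ k, 0 < l k) (hmono : StrictMono l)
    (htop : Tendsto l atTop atTop)
    (hratio : Tendsto (fun k => l (k + 1) / l k) atTop (𝓝 1))
    (hn : 2 ≤ n) :
    sSup {r : ℝ | ∃ x : Fin n → (ℕ → ℝ), (∀ j, LamNormInf l (x j) = 1) ∧
      r = sInf {s : ℝ | ∃ ε : Fin n → ℝ, (∀ j, ε j = 1 ∨ ε j = -1) ∧
        s = LamNormInf l (fun k => ∑ j, ε j * x j k)}} = n := by
  have hm := hmono.monotone
  have key : ∀ δ : ℝ, 0 < δ → ∃ r ∈ {r : ℝ | ∃ x : Fin n → (ℕ → ℝ),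
      (∀ j, LamNormInf l (x j) = 1) ∧
      r = sInf {s : ℝ | ∃ ε : Fin n → ℝ, (∀ j, ε j = 1 ∨ ε j = -1) ∧
        s = LamNormInf l (fun k => ∑ j, ε j * x j k)}}, n * (1 - δ) ≤ r := by
    intro δ hδ
    obtain ⟨x, hx, h⟩ := exists_forall_signed_sum_LamNormInf_ge hpos hm htop hδ (Fin n)
    refine ⟨_, ⟨x, hx, rfl⟩, ?_⟩
    refine le_csInf ⟨_, fun _ => 1, fun _ => Or.inl rfl, rfl⟩ ?_
    rintro _ ⟨ε, hε, rfl⟩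
    simpa using h ε hε
  refine csSup_eq_of_forall_le_of_forall_lt_exists_gt ?_ ?_ ?_
  · obtain ⟨r, hr, _⟩ := key 1 one_pos
    exact ⟨r, hr⟩
  · rintro _ ⟨x, hx, rfl⟩
    have h1 : ∀ j : Fin n, (fun _ => 1 : Fin n → ℝ) j = 1 ∨ (fun _ => 1 : Fin n → ℝ) j = -1 :=
      fun _ => Or.inl rfl
    refine le_trans (csInf_le ⟨0, ?_⟩ ⟨fun _ => 1, h1, rfl⟩) (ciSup_le fun N => ?_)
    · rintro _ ⟨ε, _, rfl⟩
      exact LamNormInf_nonneg hpos hm _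
    · simpa using LamAvg_signed_sum_le hpos hm hx h1 N
  · intro w hw
    have hn0 : (0 : ℝ) < n := by exact_mod_cast (by omega : 0 < n)
    obtain ⟨r, hr, h⟩ := key ((n - w) / (2 * n)) (div_pos (sub_pos.2 hw) (by positivity))
    refine ⟨r, hr, lt_of_lt_of_le ?_ h⟩
    have : (n : ℝ) * (1 - (n - w) / (2 * n)) = (n + w) / 2 := by field_simp; ring
    linarith
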